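/- arXiv:2509.03258 — 2 statements merged into one kernel-verified Lean document; each statement's English description precedes it below -/
import Mathlib

section
/- In the GME model setting, assume condition (C1) (𝔡(x) := f(Ax) − (μ/2)‖B𝔏x‖² is convex on X) and that f is coercive. Then J is weakly coercive: rec(J)(x) ≥ 0 for every x ∈ X, and for every x ∈ X with rec(J)(x) = 0 one has J(u + αx) = J(u) for every α ∈ ℝ and every u ∈ dom J. -/
open scoped Pointwise RealInnerProductSpace

noncomputable section

/-- Convexity for extended-real-valued functions. -/
def EConvex {H : Type*} [AddCommGroup H] [Module ℝ H] (φ : H → EReal) : Prop :=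
  ∀ (x y : H) (a b : ℝ), 0 ≤ a → 0 ≤ b → a + b = 1 →
    φ (a • x + b • y) ≤ (a : EReal) * φ x + (b : EReal) * φ y

/-- Coercivity (`φ u → ∞` as `‖u‖ → ∞`) for extended-real-valued functions. -/
def ECoercive {H : Type*} [NormedAddCommGroup H] (φ : H → EReal) : Prop :=
  ∀ C : ℝ, ∃ R : ℝ, ∀ x : H, R ≤ ‖x‖ → (C : EReal) ≤ φ x

/-- Coercivity for real-valued functions. -/
def RCoercive {H : Type*} [NormedAddCommGroup H] (φ : H → ℝ) : Prop :=
  ∀ C : ℝ, ∃ R : ℝ, ∀ x : H, R ≤ ‖x‖ → C ≤ φ x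

/-- Generalized Moreau enhanced function `Ψ_B(z) = Ψ(z) − inf_v [Ψ(v) + (1/2)‖B(z−v)‖²]`. -/
noncomputable def GME {Z Z' : Type*} [NormedAddCommGroup Z] [InnerProductSpace ℝ Z]
    [NormedAddCommGroup Z'] [InnerProductSpace ℝ Z']
    (Ψ : Z → EReal) (B : Z →ₗ[ℝ] Z') (z : Z) : EReal :=
  Ψ z - ⨅ v : Z, (Ψ v + ((((1 : ℝ) / 2) * ‖B (z - v)‖ ^ 2 : ℝ) : EReal))

/-- The cost function `J(x) = f(Ax) + μ Ψ_B(𝔏x)`. -/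
noncomputable def Jcost {X Y Z Z' : Type*}
    [NormedAddCommGroup X] [InnerProductSpace ℝ X]
    [NormedAddCommGroup Y] [InnerProductSpace ℝ Y]
    [NormedAddCommGroup Z] [InnerProductSpace ℝ Z]
    [NormedAddCommGroup Z'] [InnerProductSpace ℝ Z']
    (A : X →ₗ[ℝ] Y) (Lm : X →ₗ[ℝ] Z) (B : Z →ₗ[ℝ] Z')
    (f : Y → ℝ) (Ψ : Z → EReal) (μ : ℝ) (x : X) : EReal :=
  ((f (A x) : ℝ) : EReal) + (μ : EReal) * GME Ψ B (Lm x)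

/-- Recession function `rec(φ)(x) = sup_{v ∈ dom φ} (φ(v + x) − φ(v))`. -/
noncomputable def erec {H : Type*} [AddCommGroup H] (φ : H → EReal) (x : H) : EReal :=
  ⨆ v ∈ {v : H | φ v ≠ ⊤}, (φ (v + x) - φ v)

/-- A lower semicontinuous coercive function that never takes the value `⊥` is bounded below. -/
theorem ECoercive.exists_real_le {H : Type*} [NormedAddCommGroup H] [NormedSpace ℝ H]
    [FiniteDimensional ℝ H] {φ : H → EReal} (hc : ECoercive φ) (hl : LowerSemicontinuous φ)
    (hb : ∀ z, φ z ≠ ⊥) : ∃ m : ℝ, ∀ z, (m : EReal) ≤ φ z := by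
  obtain ⟨R, hR⟩ := hc 0
  have : ProperSpace H := FiniteDimensional.proper ℝ H
  obtain ⟨a, -, ha⟩ := LowerSemicontinuousOn.exists_isMinOn (s := Metric.closedBall (0 : H) |R|)
    ⟨0, by simp⟩ (isCompact_closedBall _ _) (hl.lowerSemicontinuousOn _)
  obtain ⟨m, -, hm⟩ := EReal.lt_iff_exists_real_btwn.1
    (lt_min (bot_lt_iff_ne_bot.2 (hb a)) (EReal.bot_lt_coe 0))
  refine ⟨m, fun z => ?_⟩
  rcases le_total R ‖z‖ with h | h
  · exact hm.le.trans ((min_le_right _ _).trans (hR z h))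
  · exact hm.le.trans ((min_le_left _ _).trans
      (ha (by simpa using h.trans (le_abs_self R))))

theorem exists_nat_le_norm_add_nsmul {H : Type*} [NormedAddCommGroup H] [NormedSpace ℝ H]
    (p : H) {y : H} (hy : y ≠ 0) (R : ℝ) : ∃ n : ℕ, R ≤ ‖p + n • y‖ := by
  have hy' : 0 < ‖y‖ := norm_pos_iff.2 hy
  obtain ⟨n, hn⟩ := exists_nat_ge ((R + ‖p‖) / ‖y‖)
  refine ⟨n, ?_⟩
  rw [div_le_iff₀ hy'] at hn
  have h1 : ‖n • y‖ = n * ‖y‖ := by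
    rw [← Nat.cast_smul_eq_nsmul ℝ, norm_smul]; simp
  have h2 : ‖n • y‖ ≤ ‖p + n • y‖ + ‖p‖ := by
    simpa using norm_sub_le (p + n • y) p
  linarith

/-- If one step in direction `x` changes `φ` by at most `c`, then `n` steps change it by at most
`n * c`. -/
theorem le_add_nat_mul_of_step_le {H : Type*} [AddCommGroup H] {φ : H → EReal} {x : H} {c : ℝ}
    (h : ∀ v, φ v ≠ ⊤ → φ (v + x) ≤ φ v + (c : EReal)) {v : H} {j : ℝ} (hv : φ v ≤ (j : EReal))
    (n : ℕ) : φ (v + n • x) ≤ ((j + n * c : ℝ) : EReal) := by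
  induction n with
  | zero => simpa using hv
  | succ n ih =>
    have h1 := h _ (ih.trans_lt (EReal.coe_lt_top _)).ne
    rw [add_assoc, ← succ_nsmul] at h1
    refine h1.trans ((add_le_add_left ih _).trans (le_of_eq ?_))
    rw [← EReal.coe_add]
    congr 1
    push_cast
    ring

theorem le_add_of_erec_le {H : Type*} [AddCommGroup H] {φ : H → EReal} (hb : ∀ v, φ v ≠ ⊥)
    {x : H} {c : ℝ} (h : erec φ x ≤ (c : EReal)) {v : H} (hv : φ v ≠ ⊤) :
    φ (v + x) ≤ φ v + (c : EReal) := by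
  have h1 : φ (v + x) - φ v ≤ (c : EReal) :=
    (le_iSup₂ (f := fun v (_ : v ∈ {v : H | φ v ≠ ⊤}) => φ (v + x) - φ v) v hv).trans h
  rw [EReal.sub_le_iff_le_add (Or.inl (hb v)) (Or.inl hv)] at h1
  rwa [add_comm (φ v)]

section MoreauEnvelope

variable {Z Z' : Type*} [NormedAddCommGroup Z] [InnerProductSpace ℝ Z]
  [NormedAddCommGroup Z'] [InnerProductSpace ℝ Z']

/-- If `Ψ` is proper and bounded below, `GME Ψ B` is `Ψ` minus a real-valued envelope. -/
theorem exists_real_envelope {Ψ : Z → EReal} (B : Z →ₗ[ℝ] Z') {m : ℝ}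
    (hm : ∀ z, (m : EReal) ≤ Ψ z) {z₀ : Z} (hz₀ : Ψ z₀ ≠ ⊤) :
    ∃ e : Z → ℝ, (∀ z, GME Ψ B z = Ψ z - (e z : EReal)) ∧ (∀ z, (e z : EReal) ≤ Ψ z) ∧
      ∀ z y, B y = 0 → e (z + y) = e z := by
  set E : Z → EReal :=
    fun z => ⨅ v : Z, (Ψ v + ((((1 : ℝ) / 2) * ‖B (z - v)‖ ^ 2 : ℝ) : EReal)) with hE
  have hbot : ∀ z, E z ≠ ⊥ := by
    intro z
    have h : (m : EReal) ≤ E z := by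
      refine le_iInf fun v => ?_
      have h0 : (0 : EReal) ≤ ((((1 : ℝ) / 2) * ‖B (z - v)‖ ^ 2 : ℝ) : EReal) :=
        EReal.coe_nonneg.2 (by positivity)
      simpa using add_le_add (hm v) h0
    exact ((EReal.bot_lt_coe m).trans_le h).ne'
  have htop : ∀ z, E z ≠ ⊤ := fun z =>
    ((iInf_le _ z₀).trans_lt (EReal.add_lt_top hz₀ (EReal.coe_ne_top _))).ne
  have hcoe : ∀ z, ((E z).toReal : EReal) = E z := fun z => EReal.coe_toReal (htop z) (hbot z)
  refine ⟨fun z => (E z).toReal, fun z => ?_, fun z => ?_, fun z y hy => ?_⟩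
  · rw [hcoe, GME]
  · rw [hcoe]
    exact (iInf_le _ z).trans (by simp)
  · simp only [hE, add_sub_right_comm z y, map_add, hy, add_zero]

end MoreauEnvelope

theorem stmt10
    {X Y Z Z' W : Type*}
    [NormedAddCommGroup X] [InnerProductSpace ℝ X] [FiniteDimensional ℝ X]
    [NormedAddCommGroup Y] [InnerProductSpace ℝ Y] [FiniteDimensional ℝ Y]
    [NormedAddCommGroup Z] [InnerProductSpace ℝ Z] [FiniteDimensional ℝ Z]
    [NormedAddCommGroup Z'] [InnerProductSpace ℝ Z'] [FiniteDimensional ℝ Z']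
    [NormedAddCommGroup W] [InnerProductSpace ℝ W] [FiniteDimensional ℝ W]
    (A : X →ₗ[ℝ] Y) (Lm : X →ₗ[ℝ] Z) (B : Z →ₗ[ℝ] Z') (Cm : X →ₗ[ℝ] W)
    (f : Y → ℝ) (hf : ConvexOn ℝ Set.univ f)
    (Ψ : Z → EReal) (hΨbot : ∀ z : Z, Ψ z ≠ ⊥) (hΨlsc : LowerSemicontinuous Ψ)
    (hΨconv : EConvex Ψ) (hΨcoer : ECoercive Ψ)
    (μ : ℝ) (hμ : 0 < μ)
    (Δ : Set W) (hΔne : Δ.Nonempty) (hΔcl : IsClosed Δ) (hΔcv : Convex ℝ Δ)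
    (hfeas : ∃ x : X, Ψ (Lm x) ≠ ⊤ ∧ Cm x ∈ Δ)
    (hC1 : ConvexOn ℝ Set.univ (fun x : X => f (A x) - μ / 2 * ‖B (Lm x)‖ ^ 2))
    (hfcoer : RCoercive f) :
    (∀ x : X, (0 : EReal) ≤ erec (Jcost A Lm B f Ψ μ) x) ∧
    (∀ x : X, erec (Jcost A Lm B f Ψ μ) x = 0 →
      ∀ (a : ℝ) (u : X), Jcost A Lm B f Ψ μ u ≠ ⊤ →
        Jcost A Lm B f Ψ μ (u + a • x) = Jcost A Lm B f Ψ μ u) := by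
  obtain ⟨m, hm⟩ := hΨcoer.exists_real_le hΨlsc hΨbot
  obtain ⟨x₀, hx₀, -⟩ := hfeas
  obtain ⟨e, hGME, he, heB⟩ := exists_real_envelope B hm hx₀
  have hfcont : Continuous f := by
    rw [← continuousOn_univ]
    exact hf.continuousOn isOpen_univ
  obtain ⟨mf, hmf⟩ := ECoercive.exists_real_le (φ := fun y => (f y : EReal))
    (fun C => (hfcoer C).imp fun R hR x hx => EReal.coe_le_coe_iff.2 (hR x hx))
    (continuous_coe_real_ereal.comp hfcont).lowerSemicontinuous (fun z => EReal.coe_ne_bot _)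
  set J := Jcost A Lm B f Ψ μ with hJ
  have hJeq : ∀ x, J x = (f (A x) : EReal) + (μ : EReal) * (Ψ (Lm x) - (e (Lm x) : EReal)) :=
    fun x => by rw [hJ, Jcost, hGME]
  have hJreal : ∀ x (r : ℝ), Ψ (Lm x) = r → J x = ((f (A x) + μ * (r - e (Lm x)) : ℝ) : EReal) := by
    intro x r hr
    rw [hJeq, hr]
    norm_cast
  have hJtop : ∀ x, Ψ (Lm x) = ⊤ → J x = ⊤ := by
    intro x hr
    rw [hJeq, hr, EReal.top_sub_coe, EReal.coe_mul_top_of_pos hμ, EReal.coe_add_top]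
  have hcases : ∀ x, Ψ (Lm x) = ⊤ ∨ ∃ r : ℝ, Ψ (Lm x) = r := fun x =>
    (eq_or_ne (Ψ (Lm x)) ⊤).imp id fun h => ⟨_, (EReal.coe_toReal h (hΨbot _)).symm⟩
  have hfJ : ∀ x, (f (A x) : EReal) ≤ J x := by
    intro x
    rcases hcases x with h | ⟨r, hr⟩
    · rw [hJtop x h]; exact le_top
    · rw [hJreal x r hr, EReal.coe_le_coe_iff]
      have h1 : e (Lm x) ≤ r := by simpa [hr] using he (Lm x)
      have h2 := mul_nonneg hμ.le (sub_nonneg.2 h1)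
      linarith
  have hJbot : ∀ x, J x ≠ ⊥ := fun x => ((EReal.bot_lt_coe _).trans_le (hfJ x)).ne'
  obtain ⟨r₀, hr₀⟩ := (hcases x₀).resolve_left hx₀
  have hj₀ := hJreal x₀ r₀ hr₀
  set j₀ := f (A x₀) + μ * (r₀ - e (Lm x₀))
  refine ⟨fun x => ?_, fun x hx => ?_⟩
  · by_contra! hlt
    obtain ⟨c, hc, hc0⟩ := EReal.lt_iff_exists_real_btwn.1 hlt
    have hc0 : c < 0 := by exact_mod_cast hc0
    obtain ⟨n, hn⟩ := exists_nat_gt ((j₀ - mf) / (-c))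
    rw [div_lt_iff₀ (by linarith)] at hn
    have h1 := le_add_nat_mul_of_step_le (fun v hv => le_add_of_erec_le hJbot hc.le hv) hj₀.le n
    have h2 : mf ≤ j₀ + n * c :=
      EReal.coe_le_coe_iff.1 ((hmf _).trans ((hfJ _).trans h1))
    linarith
  · have hle : ∀ n : ℕ, J (x₀ + n • x) ≤ (j₀ : EReal) := fun n => by
      simpa using le_add_nat_mul_of_step_le (c := 0)
        (fun v hv => le_add_of_erec_le hJbot (by simp [hx]) hv) hj₀.le n
    have hA : A x = 0 := by
      by_contra hne
      obtain ⟨R, hR⟩ := hfcoer (j₀ + 1)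
      obtain ⟨n, hn⟩ := exists_nat_le_norm_add_nsmul (A x₀) hne R
      have h1 := EReal.coe_le_coe_iff.1 ((hfJ _).trans (hle n))
      rw [map_add, map_nsmul] at h1
      linarith [hR _ hn]
    have hB : B (Lm x) = 0 := by
      have h1 := hC1.2 (Set.mem_univ x) (Set.mem_univ (-x)) (by norm_num : (0 : ℝ) ≤ 1 / 2)
        (by norm_num : (0 : ℝ) ≤ 1 / 2) (by norm_num)
      simp only [smul_neg, add_neg_cancel, map_neg, hA, map_zero, norm_neg, neg_zero, norm_zero,
        smul_eq_mul] at h1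
      have h2 : μ * ‖B (Lm x)‖ ^ 2 ≤ 0 := by nlinarith
      have h3 : ‖B (Lm x)‖ ^ 2 ≤ 0 := nonpos_of_mul_nonpos_right h2 hμ
      simpa using le_antisymm h3 (sq_nonneg _)
    have hL : Lm x = 0 := by
      by_contra hne
      obtain ⟨R, hR⟩ := hΨcoer (r₀ + 1)
      obtain ⟨n, hn⟩ := exists_nat_le_norm_add_nsmul (Lm x₀) hne R
      have h1 := hle n
      have h2 := hR _ hn
      rw [← map_nsmul, ← map_add] at h2
      rcases hcases (x₀ + n • x) with h | ⟨r, hr⟩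
      · rw [hJtop _ h] at h1
        exact (EReal.coe_ne_top _) (top_le_iff.1 h1)
      · rw [hJreal _ r hr, EReal.coe_le_coe_iff] at h1
        rw [hr, EReal.coe_le_coe_iff] at h2
        rw [map_add, map_add, map_nsmul, map_nsmul, hA, smul_zero, add_zero,
          heB _ _ (by rw [map_nsmul, hB, smul_zero])] at h1
        have h3 : r - e (Lm x₀) ≤ r₀ - e (Lm x₀) :=
          le_of_mul_le_mul_left (by simpa [j₀] using h1) hμ
        linarith
    intro a u _
    simp only [hJeq, map_add, map_smul, hA, hL, smul_zero, add_zero]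
end
end

section
/- In the GME model setting, assume condition (C1) (𝔡(x) := f(Ax) − (μ/2)‖B𝔏x‖² is convex on X). If either (i) f is coercive and null A ∩ null 𝔏 = {0}, or (ii) f is bounded below and null 𝔏 = {0}, then the constrained problem has a minimizer: there exists x* ∈ X with ℭx* ∈ Δ such that J(x*) ≤ J(x) for every x ∈ X with ℭx ∈ Δ. -/
open scoped Pointwise RealInnerProductSpace

noncomputable section

/-- The generalized Moreau envelope `inf_v [Ψ(v) + (1/2)‖B(z−v)‖²]`. -/
def moreauEnvelope {Z Z' : Type*} [NormedAddCommGroup Z] [InnerProductSpace ℝ Z]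
    [NormedAddCommGroup Z'] [InnerProductSpace ℝ Z']
    (Ψ : Z → EReal) (B : Z →ₗ[ℝ] Z') (z : Z) : EReal :=
  ⨅ v : Z, (Ψ v + ((((1 : ℝ) / 2) * ‖B (z - v)‖ ^ 2 : ℝ) : EReal))

/-- A coercive, lower semicontinuous function that avoids `⊥` is bounded below. -/
theorem ECoercive.exists_coe_le {H : Type*} [NormedAddCommGroup H] [ProperSpace H]
    {φ : H → EReal} (hcoer : ECoercive φ) (hlsc : LowerSemicontinuous φ)
    (hbot : ∀ x, φ x ≠ ⊥) : ∃ m : ℝ, ∀ x, (m : EReal) ≤ φ x := by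
  obtain ⟨R, hR⟩ := hcoer 0
  obtain ⟨a, -, ha⟩ := LowerSemicontinuousOn.exists_isMinOn
    (Metric.nonempty_closedBall.2 (abs_nonneg R)) (isCompact_closedBall (0 : H) |R|)
    (hlsc.lowerSemicontinuousOn _)
  obtain ⟨m, hm⟩ : ∃ m : ℝ, (m : EReal) ≤ φ a := by
    obtain ⟨m, -, hm⟩ := EReal.lt_iff_exists_real_btwn.1 (bot_lt_iff_ne_bot.2 (hbot a))
    exact ⟨m, hm.le⟩
  refine ⟨min 0 m, fun x => ?_⟩
  rcases le_total R ‖x‖ with hx | hx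
  · exact (EReal.coe_le_coe_iff.2 (min_le_left 0 m)).trans (hR x hx)
  · refine (EReal.coe_le_coe_iff.2 (min_le_right 0 m)).trans (hm.trans (ha ?_))
    simpa using hx.trans (le_abs_self R)

/-- A continuous coercive real-valued function is bounded below. -/
theorem RCoercive.exists_le {H : Type*} [NormedAddCommGroup H] [ProperSpace H]
    {φ : H → ℝ} (hcoer : RCoercive φ) (hcont : Continuous φ) : ∃ c : ℝ, ∀ x, c ≤ φ x := by
  have hE : ECoercive (fun x => (φ x : EReal)) := fun C =>
    (hcoer C).imp fun _ hR x hx => EReal.coe_le_coe_iff.2 (hR x hx)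
  obtain ⟨m, hm⟩ := hE.exists_coe_le
    (continuous_coe_real_ereal.comp hcont).lowerSemicontinuous (fun x => EReal.coe_ne_bot _)
  exact ⟨m, fun x => EReal.coe_le_coe_iff.1 (hm x)⟩

section Envelope

variable {Z Z' : Type*} [NormedAddCommGroup Z] [InnerProductSpace ℝ Z]
  [NormedAddCommGroup Z'] [InnerProductSpace ℝ Z'] {Ψ : Z → EReal} {B : Z →ₗ[ℝ] Z'}

theorem moreauEnvelope_le_self (z : Z) : moreauEnvelope Ψ B z ≤ Ψ z :=
  (iInf_le _ z).trans (by simp)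

theorem le_moreauEnvelope {m : ℝ} (hm : ∀ v, (m : EReal) ≤ Ψ v) (z : Z) :
    (m : EReal) ≤ moreauEnvelope Ψ B z :=
  le_iInf fun v => (hm v).trans <| le_add_of_nonneg_right <| by
    exact_mod_cast (by positivity : (0 : ℝ) ≤ 1 / 2 * ‖B (z - v)‖ ^ 2)

theorem moreauEnvelope_le_coe {v : Z} {p : ℝ} (hv : Ψ v = p) (z : Z) :
    moreauEnvelope Ψ B z ≤ ((p + 1 / 2 * ‖B z - B v‖ ^ 2 : ℝ) : EReal) :=
  (iInf_le _ v).trans (by rw [hv, map_sub, EReal.coe_add])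

theorem upperSemicontinuous_moreauEnvelope [FiniteDimensional ℝ Z] :
    UpperSemicontinuous (moreauEnvelope Ψ B) := by
  refine upperSemicontinuous_iInf fun v => Continuous.upperSemicontinuous ?_
  have hB : Continuous B := B.continuous_of_finiteDimensional
  have hq : Continuous fun z : Z => (((1 / 2 * ‖B (z - v)‖ ^ 2 : ℝ)) : EReal) :=
    continuous_coe_real_ereal.comp (by fun_prop)
  refine continuous_iff_continuousAt.2 fun z => ?_
  exact (EReal.continuousAt_add (p := (Ψ v, ((1 / 2 * ‖B (z - v)‖ ^ 2 : ℝ) : EReal)))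
    (Or.inr (EReal.coe_ne_bot _)) (Or.inr (EReal.coe_ne_top _))).comp
    (f := fun z : Z => (Ψ v, ((1 / 2 * ‖B (z - v)‖ ^ 2 : ℝ) : EReal)))
    (continuousAt_const.prodMk hq.continuousAt)

theorem moreauEnvelope_ne_bot {m : ℝ} (hm : ∀ v, (m : EReal) ≤ Ψ v) (z : Z) :
    moreauEnvelope Ψ B z ≠ ⊥ :=
  ((EReal.bot_lt_coe m).trans_le (le_moreauEnvelope hm z)).ne'

theorem moreauEnvelope_ne_top {v : Z} {p : ℝ} (hv : Ψ v = p) (z : Z) :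
    moreauEnvelope Ψ B z ≠ ⊤ :=
  ((moreauEnvelope_le_coe hv z).trans_lt (EReal.coe_lt_top _)).ne

theorem lowerSemicontinuous_GME [FiniteDimensional ℝ Z] (hlsc : LowerSemicontinuous Ψ)
    {m : ℝ} (hm : ∀ v, (m : EReal) ≤ Ψ v) {v : Z} {p : ℝ} (hv : Ψ v = p) :
    LowerSemicontinuous (GME Ψ B) := by
  have hneg : LowerSemicontinuous fun z => -moreauEnvelope Ψ B z :=
    continuous_neg.comp_upperSemicontinuous_antitone upperSemicontinuous_moreauEnvelope
      fun _ _ h => EReal.neg_le_neg_iff.2 h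
  refine hlsc.add' hneg fun z => EReal.continuousAt_add (Or.inr ?_) (Or.inr ?_)
  · exact fun h => moreauEnvelope_ne_top (B := B) hv z (EReal.neg_eq_bot_iff.1 h)
  · exact fun h => moreauEnvelope_ne_bot (B := B) hm z (EReal.neg_eq_top_iff.1 h)

end Envelope

section Cost

variable {X Y Z Z' : Type*}
  [NormedAddCommGroup X] [InnerProductSpace ℝ X]
  [NormedAddCommGroup Y] [InnerProductSpace ℝ Y]
  [NormedAddCommGroup Z] [InnerProductSpace ℝ Z]
  [NormedAddCommGroup Z'] [InnerProductSpace ℝ Z']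
  {A : X →ₗ[ℝ] Y} {Lm : X →ₗ[ℝ] Z} {B : Z →ₗ[ℝ] Z'}
  {f : Y → ℝ} {Ψ : Z → EReal} {μ : ℝ}

theorem lowerSemicontinuous_Jcost [FiniteDimensional ℝ X] [FiniteDimensional ℝ Z]
    (hf : Continuous f) (hμ : 0 < μ) (hlsc : LowerSemicontinuous Ψ)
    {m : ℝ} (hm : ∀ v, (m : EReal) ≤ Ψ v) {v : Z} {p : ℝ} (hv : Ψ v = p) :
    LowerSemicontinuous (Jcost A Lm B f Ψ μ) := by
  have hA : Continuous A := A.continuous_of_finiteDimensional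
  have hL : Continuous Lm := Lm.continuous_of_finiteDimensional
  have hmul : Continuous fun t : EReal => (μ : EReal) * t := by
    refine continuous_iff_continuousAt.2 fun t => ?_
    have h0 : (μ : EReal) ≠ 0 := EReal.coe_ne_zero.2 hμ.ne'
    exact (EReal.continuousAt_mul (p := ((μ : EReal), t)) (Or.inl h0) (Or.inl h0)
      (Or.inl (EReal.coe_ne_bot μ)) (Or.inl (EReal.coe_ne_top μ))).comp
      (f := fun t : EReal => ((μ : EReal), t)) (continuousAt_const.prodMk continuousAt_id)
  have hfA : LowerSemicontinuous fun x => ((f (A x) : ℝ) : EReal) :=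
    (continuous_coe_real_ereal.comp (hf.comp hA)).lowerSemicontinuous
  have hG : LowerSemicontinuous fun x => (μ : EReal) * GME Ψ B (Lm x) :=
    hmul.comp_lowerSemicontinuous ((lowerSemicontinuous_GME hlsc hm hv).comp hL)
      fun _ _ h => mul_le_mul_of_nonneg_left h (EReal.coe_nonneg.2 hμ.le)
  exact hfA.add' hG fun x => EReal.continuousAt_add
    (Or.inl (EReal.coe_ne_top _)) (Or.inl (EReal.coe_ne_bot _))

/-- Strong convexity of `f ∘ A` along `B ∘ Lm` turns an upper bound on `f (A x)` into a bound on
`‖B (Lm x)‖`. -/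
theorem norm_sq_le_of_convexOn_sub
    (hconv : ConvexOn ℝ Set.univ (fun x : X => f (A x) - μ / 2 * ‖B (Lm x)‖ ^ 2))
    {c : ℝ} (hc : ∀ y, c ≤ f y) (x : X) :
    μ / 8 * ‖B (Lm x)‖ ^ 2 ≤ (f 0 + f (A x)) / 2 - c := by
  have h := hconv.2 (Set.mem_univ (0 : X)) (Set.mem_univ x)
    (by norm_num : (0 : ℝ) ≤ 1 / 2) (by norm_num : (0 : ℝ) ≤ 1 / 2) (by norm_num)
  simp only [smul_zero, zero_add, map_smul, map_zero, norm_zero, smul_eq_mul, norm_smul] at h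
  have hc' := hc ((1 / 2 : ℝ) • A x)
  norm_num at h hc'
  nlinarith

/-- On a sublevel set of the cost, `f (A x)` and `Ψ (Lm x)` are bounded above. -/
theorem exists_bound_of_Jcost_le (hμ : 0 < μ)
    (hconv : ConvexOn ℝ Set.univ (fun x : X => f (A x) - μ / 2 * ‖B (Lm x)‖ ^ 2))
    {c : ℝ} (hc : ∀ y, c ≤ f y)
    {m : ℝ} (hm : ∀ v, (m : EReal) ≤ Ψ v) {v : Z} {p : ℝ} (hv : Ψ v = p) (C : ℝ) :
    ∃ M : ℝ, ∀ x, Jcost A Lm B f Ψ μ x ≤ C → f (A x) ≤ C ∧ Ψ (Lm x) ≤ M := by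
  refine ⟨p + (8 / μ * ((f 0 + C) / 2 - c) + ‖B v‖ ^ 2) + (C - c) / μ, fun x hx => ?_⟩
  have hxG : ((f (A x) : ℝ) : EReal) +
      (μ : EReal) * (Ψ (Lm x) - moreauEnvelope Ψ B (Lm x)) ≤ C := hx
  have hle := moreauEnvelope_le_self (Ψ := Ψ) (B := B) (Lm x)
  have hub := moreauEnvelope_le_coe (B := B) hv (Lm x)
  have hbot : Ψ (Lm x) ≠ ⊥ := ((EReal.bot_lt_coe m).trans_le (hm _)).ne'
  lift moreauEnvelope Ψ B (Lm x) to ℝ using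
    ⟨moreauEnvelope_ne_top hv _, moreauEnvelope_ne_bot hm _⟩ with g hg
  have htop : Ψ (Lm x) ≠ ⊤ := by
    intro h
    rw [h, EReal.top_sub_coe, EReal.coe_mul_top_of_pos hμ, EReal.coe_add_top] at hxG
    exact EReal.coe_ne_top C (top_le_iff.1 hxG)
  lift Ψ (Lm x) to ℝ using ⟨htop, hbot⟩ with q hq
  norm_cast at hxG hle hub ⊢
  have hfC : f (A x) ≤ C := by nlinarith
  have hB := norm_sq_le_of_convexOn_sub hconv hc x
  have hB' : ‖B (Lm x)‖ ^ 2 ≤ 8 / μ * ((f 0 + C) / 2 - c) := by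
    rw [div_mul_eq_mul_div, le_div_iff₀ hμ]
    linarith
  have hsub : 1 / 2 * ‖B (Lm x) - B v‖ ^ 2 ≤ ‖B (Lm x)‖ ^ 2 + ‖B v‖ ^ 2 := by
    have := parallelogram_law_with_norm ℝ (B (Lm x)) (B v)
    nlinarith [sq_nonneg ‖B (Lm x) + B v‖]
  have hqg : q - g ≤ (C - c) / μ := by
    rw [le_div_iff₀ hμ]
    linarith [hc (A x)]
  exact ⟨hfC, by linarith⟩

/-- Sublevel sets of the cost are bounded. -/
theorem exists_norm_le_of_Jcost_le [FiniteDimensional ℝ X] (hμ : 0 < μ)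
    (hconv : ConvexOn ℝ Set.univ (fun x : X => f (A x) - μ / 2 * ‖B (Lm x)‖ ^ 2))
    {c : ℝ} (hc : ∀ y, c ≤ f y) (hΨcoer : ECoercive Ψ)
    {m : ℝ} (hm : ∀ v, (m : EReal) ≤ Ψ v) {v : Z} {p : ℝ} (hv : Ψ v = p)
    (hcase : (RCoercive f ∧ LinearMap.ker A ⊓ LinearMap.ker Lm = ⊥) ∨ LinearMap.ker Lm = ⊥)
    (C : ℝ) : ∃ R : ℝ, ∀ x, Jcost A Lm B f Ψ μ x ≤ C → ‖x‖ ≤ R := by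
  obtain ⟨M, hM⟩ := exists_bound_of_Jcost_le hμ hconv hc hm hv C
  obtain ⟨R₁, hR₁⟩ := hΨcoer (M + 1)
  have hLx : ∀ x, Jcost A Lm B f Ψ μ x ≤ C → ‖Lm x‖ ≤ R₁ := by
    intro x hx
    by_contra! hlt
    have := EReal.coe_le_coe_iff.1 ((hR₁ _ hlt.le).trans (hM x hx).2)
    linarith
  rcases hcase with ⟨hfcoer, hker⟩ | hker
  · obtain ⟨R₂, hR₂⟩ := hfcoer (C + 1)
    have hAx : ∀ x, Jcost A Lm B f Ψ μ x ≤ C → ‖A x‖ ≤ R₂ := by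
      intro x hx
      by_contra! hlt
      linarith [hR₂ _ hlt.le, (hM x hx).1]
    obtain ⟨K, -, hK⟩ := (A.prod Lm).exists_antilipschitzWith
      ((LinearMap.ker_prod A Lm).trans hker)
    refine ⟨K * max R₂ R₁, fun x hx => ?_⟩
    have h := hK.le_mul_dist x 0
    rw [map_zero, dist_zero_right, dist_zero_right] at h
    exact h.trans (mul_le_mul_of_nonneg_left (max_le_max (hAx x hx) (hLx x hx)) K.2)
  · obtain ⟨K, -, hK⟩ := Lm.exists_antilipschitzWith hker
    refine ⟨K * R₁, fun x hx => ?_⟩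
    have h := hK.le_mul_dist x 0
    rw [map_zero, dist_zero_right, dist_zero_right] at h
    exact h.trans (mul_le_mul_of_nonneg_left (hLx x hx) K.2)

end Cost

/-- A lower semicontinuous function attains its minimum on a closed set as soon as some sublevel
set meeting that set is bounded. -/
theorem exists_min_of_bounded_sublevel {X : Type*} [NormedAddCommGroup X] [ProperSpace X]
    {J : X → EReal} (hJ : LowerSemicontinuous J) {S : Set X} (hS : IsClosed S)
    {x₀ : X} (hx₀ : x₀ ∈ S) {R : ℝ} (hR : ∀ x, J x ≤ J x₀ → ‖x‖ ≤ R) :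
    ∃ xs ∈ S, ∀ x ∈ S, J xs ≤ J x := by
  have hx₀K : x₀ ∈ Metric.closedBall 0 R ∩ S := ⟨by simpa using hR x₀ le_rfl, hx₀⟩
  obtain ⟨xs, hxs, hmin⟩ := LowerSemicontinuousOn.exists_isMinOn ⟨x₀, hx₀K⟩
    ((isCompact_closedBall (0 : X) R).inter_right hS) (hJ.lowerSemicontinuousOn _)
  refine ⟨xs, hxs.2, fun x hx => ?_⟩
  rcases le_total (J x) (J x₀) with h | h
  · exact hmin ⟨by simpa using hR x h, hx⟩
  · exact (hmin hx₀K).trans h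

theorem stmt12
    {X Y Z Z' W : Type*}
    [NormedAddCommGroup X] [InnerProductSpace ℝ X] [FiniteDimensional ℝ X]
    [NormedAddCommGroup Y] [InnerProductSpace ℝ Y] [FiniteDimensional ℝ Y]
    [NormedAddCommGroup Z] [InnerProductSpace ℝ Z] [FiniteDimensional ℝ Z]
    [NormedAddCommGroup Z'] [InnerProductSpace ℝ Z'] [FiniteDimensional ℝ Z']
    [NormedAddCommGroup W] [InnerProductSpace ℝ W] [FiniteDimensional ℝ W]
    (A : X →ₗ[ℝ] Y) (Lm : X →ₗ[ℝ] Z) (B : Z →ₗ[ℝ] Z') (Cm : X →ₗ[ℝ] W)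
    (f : Y → ℝ) (hf : ConvexOn ℝ Set.univ f)
    (Ψ : Z → EReal) (hΨbot : ∀ z : Z, Ψ z ≠ ⊥) (hΨlsc : LowerSemicontinuous Ψ)
    (hΨconv : EConvex Ψ) (hΨcoer : ECoercive Ψ)
    (μ : ℝ) (hμ : 0 < μ)
    (Δ : Set W) (hΔne : Δ.Nonempty) (hΔcl : IsClosed Δ) (hΔcv : Convex ℝ Δ)
    (hfeas : ∃ x : X, Ψ (Lm x) ≠ ⊤ ∧ Cm x ∈ Δ)
    (hC1 : ConvexOn ℝ Set.univ (fun x : X => f (A x) - μ / 2 * ‖B (Lm x)‖ ^ 2))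
    (hcase : (RCoercive f ∧ LinearMap.ker A ⊓ LinearMap.ker Lm = ⊥) ∨
      ((∃ c : ℝ, ∀ y : Y, c ≤ f y) ∧ LinearMap.ker Lm = ⊥)) :
    ∃ xs : X, Cm xs ∈ Δ ∧
      ∀ x : X, Cm x ∈ Δ → Jcost A Lm B f Ψ μ xs ≤ Jcost A Lm B f Ψ μ x := by
  have hfc : Continuous f := hf.locallyLipschitz.continuous
  obtain ⟨m, hm⟩ := hΨcoer.exists_coe_le hΨlsc hΨbot
  obtain ⟨c, hc⟩ : ∃ c : ℝ, ∀ y, c ≤ f y := hcase.elim (fun h => h.1.exists_le hfc) (·.1)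
  obtain ⟨x₀, hx₀, hx₀Δ⟩ := hfeas
  obtain ⟨p, hp⟩ : ∃ p : ℝ, Ψ (Lm x₀) = p :=
    ⟨_, (EReal.coe_toReal hx₀ (hΨbot _)).symm⟩
  have hJ₀ : Jcost A Lm B f Ψ μ x₀ ≤
      ((f (A x₀) + μ * (p - m) : ℝ) : EReal) := by
    have hG : GME Ψ B (Lm x₀) ≤ ((p - m : ℝ) : EReal) :=
      EReal.sub_le_sub hp.le (le_moreauEnvelope hm (Lm x₀))
    rw [EReal.coe_add, EReal.coe_mul]
    exact add_le_add_right (mul_le_mul_of_nonneg_left hG (EReal.coe_nonneg.2 hμ.le)) _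
  obtain ⟨R, hR⟩ := exists_norm_le_of_Jcost_le hμ hC1 hc hΨcoer hm hp
    (hcase.imp_right (·.2)) (f (A x₀) + μ * (p - m))
  exact exists_min_of_bounded_sublevel (S := Cm ⁻¹' Δ)
    (lowerSemicontinuous_Jcost hfc hμ hΨlsc hm hp)
    (hΔcl.preimage Cm.continuous_of_finiteDimensional) hx₀Δ fun x hx => hR x (hx.trans hJ₀)
end
end
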